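/- Under the hypotheses of the local asymptotic minimax theorem (families {Q_t : t ∈ T} on (Y, A) and {P_{n,t} : t ∈ T_n} on (Ω_n, F_n) with liminf T_n = T; nonnegative loss L; for each finite S ⊆ T there exist probability kernels K_n from (Y, A) to (Ω_n, F_n) with max_{t ∈ S} ‖Q_t K_n − P_{n,t}‖₁ → 0; and the minimax equality R = sup_{S finite, M>0} inf_ρ max_{t ∈ S} ∫∫ (M ∧ L_t) dρ dQ_t where R = inf_ρ sup_{t ∈ T} ∫∫ L_t dρ dQ_t): for every sequence of probability kernels τ_n from (Ω_n, F_n) to T, liminf_{n → ∞} sup_{t ∈ T_n} ∫∫ L_t(z) τ_{n,ω}(dz) P_{n,t}(dω) ≥ R. -/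

import Mathlib

open MeasureTheory ProbabilityTheory Filter Topology
open scoped ENNReal NNReal

/-- Total variation distance between two measures:
`‖μ − ν‖₁ = sup { |∫ f dμ − ∫ f dν| : f measurable, |f| ≤ 1 }`. -/
noncomputable def tvDist {α : Type*} [MeasurableSpace α] (μ ν : Measure α) : ℝ :=
  ⨆ f : { f : α → ℝ // Measurable f ∧ ∀ x, |f x| ≤ 1 },
    |∫ x, f.1 x ∂μ - ∫ x, f.1 x ∂ν|

lemma abs_integral_sub_le_tvDist {α : Type*} [MeasurableSpace α] (μ ν : Measure α)
    [IsProbabilityMeasure μ] [IsProbabilityMeasure ν] {f : α → ℝ} (hf : Measurable f)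
    (hf1 : ∀ x, |f x| ≤ 1) :
    |∫ x, f x ∂μ - ∫ x, f x ∂ν| ≤ tvDist μ ν := by
  have key (κ : Measure α) [IsProbabilityMeasure κ] {g : α → ℝ} (hg : ∀ x, |g x| ≤ 1) :
      |∫ x, g x ∂κ| ≤ 1 := by
    simpa using norm_integral_le_of_norm_le_const (μ := κ) (f := g) (C := 1)
      (Eventually.of_forall hg)
  refine le_ciSup (f := fun f : { f : α → ℝ // Measurable f ∧ ∀ x, |f x| ≤ 1 } =>
    |∫ x, f.1 x ∂μ - ∫ x, f.1 x ∂ν|) ⟨2, ?_⟩ ⟨f, hf, hf1⟩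
  rintro _ ⟨g, rfl⟩
  calc |∫ x, g.1 x ∂μ - ∫ x, g.1 x ∂ν|
      ≤ |∫ x, g.1 x ∂μ| + |∫ x, g.1 x ∂ν| := abs_sub _ _
    _ ≤ 2 := by linarith [key μ g.2.2, key ν g.2.2]

lemma tvDist_nonneg {α : Type*} [MeasurableSpace α] (μ ν : Measure α) : 0 ≤ tvDist μ ν :=
  Real.iSup_nonneg fun _ => abs_nonneg _

lemma lintegral_le_lintegral_add_tvDist {α : Type*} [MeasurableSpace α] (μ ν : Measure α)
    [IsProbabilityMeasure μ] [IsProbabilityMeasure ν] {g : α → ℝ≥0∞} (hg : Measurable g)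
    {M : ℝ≥0∞} (hM0 : M ≠ 0) (hM : M ≠ ⊤) (hgM : ∀ x, g x ≤ M) :
    ∫⁻ x, g x ∂μ ≤ ∫⁻ x, g x ∂ν + M * ENNReal.ofReal (tvDist μ ν) := by
  let f : α → ℝ := fun x => (g x / M).toReal
  have hdiv (x : α) : g x / M ≤ 1 := ENNReal.div_le_of_le_mul (by simpa using hgM x)
  have hf : Measurable f := (hg.div_const M).ennreal_toReal
  have hf0 (x : α) : 0 ≤ f x := ENNReal.toReal_nonneg
  have hf1 (x : α) : |f x| ≤ 1 := by
    rw [abs_of_nonneg (hf0 x)]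
    exact ENNReal.toReal_le_of_le_ofReal zero_le_one (by simpa using hdiv x)
  have hgf (x : α) : g x = M * ENNReal.ofReal (f x) := by
    rw [ENNReal.ofReal_toReal (ne_top_of_le_ne_top ENNReal.one_ne_top (hdiv x)),
      ENNReal.mul_div_cancel hM0 hM]
  have key (κ : Measure α) [IsProbabilityMeasure κ] :
      ∫⁻ x, g x ∂κ = M * ENNReal.ofReal (∫ x, f x ∂κ) := by
    have hint : Integrable f κ :=
      Integrable.of_bound hf.aestronglyMeasurable 1 (Eventually.of_forall hf1)
    rw [ofReal_integral_eq_lintegral_ofReal hint (Eventually.of_forall hf0),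
      ← lintegral_const_mul _ hf.ennreal_ofReal]
    exact lintegral_congr hgf
  rw [key μ, key ν, ← mul_add,
    ← ENNReal.ofReal_add (integral_nonneg hf0) (tvDist_nonneg μ ν)]
  gcongr
  linarith [(abs_le.1 (abs_integral_sub_le_tvDist μ ν hf hf1)).2]

lemma le_biSup_finset_real {ι : Type*} (S : Finset ι) {f : ι → ℝ} (hf : ∀ i, 0 ≤ f i)
    {i : ι} (hi : i ∈ S) : f i ≤ ⨆ j ∈ S, f j := by
  have hbdd : BddAbove (Set.range fun j => ⨆ _ : j ∈ S, f j) := by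
    refine ⟨∑ j ∈ S, f j, ?_⟩
    rintro _ ⟨j, rfl⟩
    exact Real.iSup_le (fun hj => Finset.single_le_sum (fun k _ => hf k) hj)
      (Finset.sum_nonneg fun k _ => hf k)
  have h := le_ciSup hbdd i
  rwa [ciSup_pos hi] at h

/-- **Consequence of the local asymptotic minimax theorem:**
`liminf_n sup_{t ∈ Tₙ} ∬ L_t dτₙ dP_{n,t} ≥ R` for every sequence of randomized
estimators `τₙ`. -/
theorem statement10 {T 𝓨 : Type*} [MeasurableSpace T] [MeasurableSpace 𝓨]
    {Ω : ℕ → Type*} [∀ n, MeasurableSpace (Ω n)]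
    (L : T → T → ℝ≥0∞) (hL : ∀ t, Measurable (L t))
    (Q : T → Measure 𝓨) [∀ t, IsProbabilityMeasure (Q t)]
    (Tn : ℕ → Set T) (hTn : ∀ t : T, ∀ᶠ n in atTop, t ∈ Tn n)
    (P : (n : ℕ) → T → Measure (Ω n))
    (hP : ∀ n, ∀ t ∈ Tn n, IsProbabilityMeasure (P n t))
    (R : ℝ≥0∞)
    (hR : R = ⨅ ρ : { ρ : Kernel 𝓨 T // IsMarkovKernel ρ },
        ⨆ t : T, ∫⁻ y, ∫⁻ z, L t z ∂(ρ.1 y) ∂(Q t))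
    (ha : ∀ S : Finset T, ∃ K : (n : ℕ) → Kernel 𝓨 (Ω n),
        (∀ n, IsMarkovKernel (K n)) ∧
        Tendsto (fun n => ⨆ t ∈ S, tvDist ((Q t).bind (K n)) (P n t)) atTop (𝓝 0))
    (hb : R = ⨆ (S : Finset T) (M : ℝ≥0∞) (_ : 0 < M ∧ M ≠ ⊤),
        ⨅ ρ : { ρ : Kernel 𝓨 T // IsMarkovKernel ρ },
          ⨆ t ∈ S, ∫⁻ y, ∫⁻ z, min M (L t z) ∂(ρ.1 y) ∂(Q t)) :
    ∀ τ : (n : ℕ) → Kernel (Ω n) T, (∀ n, IsMarkovKernel (τ n)) →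
      R ≤ liminf (fun n => ⨆ t ∈ Tn n, ∫⁻ ω, ∫⁻ z, L t z ∂(τ n ω) ∂(P n t)) atTop := by
  intro τ hτ
  rw [hb]
  refine iSup_le fun S => iSup_le fun M => iSup_le fun hM => ?_
  obtain ⟨K, hK, hlim⟩ := ha S
  have hlim' : Tendsto (fun n => M * ENNReal.ofReal
      (⨆ t ∈ S, tvDist ((Q t).bind (K n)) (P n t))) atTop (𝓝 0) := by
    simpa using ENNReal.Tendsto.const_mul (ENNReal.tendsto_ofReal hlim) (Or.inr hM.2)
  refine ENNReal.le_of_forall_pos_le_add fun ε hε _ => ?_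
  rw [← tsub_le_iff_right]
  refine le_liminf_of_le (by isBoundedDefault) ?_
  have hS : ∀ᶠ n in atTop, ∀ t ∈ S, t ∈ Tn n :=
    (Filter.eventually_all_finset S).2 fun t _ => hTn t
  filter_upwards [hS, hlim'.eventually_le_const (ENNReal.coe_pos.2 hε)] with n hn hεn
  rw [tsub_le_iff_right]
  refine iInf_le_of_le ⟨τ n ∘ₖ K n, inferInstance⟩ (iSup₂_le fun t ht => ?_)
  have := hP n t (hn t ht)
  have hmin : Measurable fun z => min M (L t z) := measurable_const.min (hL t)
  have hmeas : Measurable fun ω => ∫⁻ z, min M (L t z) ∂(τ n ω) := hmin.lintegral_kernel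
  calc ∫⁻ y, ∫⁻ z, min M (L t z) ∂((τ n ∘ₖ K n) y) ∂(Q t)
      = ∫⁻ ω, ∫⁻ z, min M (L t z) ∂(τ n ω) ∂((Q t).bind (K n)) := by
        rw [Measure.lintegral_bind (K n).aemeasurable hmeas.aemeasurable]
        exact lintegral_congr fun y => Kernel.lintegral_comp _ _ _ hmin
    _ ≤ ∫⁻ ω, ∫⁻ z, min M (L t z) ∂(τ n ω) ∂(P n t)
        + M * ENNReal.ofReal (tvDist ((Q t).bind (K n)) (P n t)) := by
        refine lintegral_le_lintegral_add_tvDist _ _ hmeas hM.1.ne' hM.2 fun ω => ?_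
        calc ∫⁻ z, min M (L t z) ∂(τ n ω) ≤ ∫⁻ _, M ∂(τ n ω) :=
              lintegral_mono fun z => min_le_left _ _
          _ = M := by simp
    _ ≤ (⨆ t ∈ Tn n, ∫⁻ ω, ∫⁻ z, L t z ∂(τ n ω) ∂(P n t)) + ε := by
        refine add_le_add ?_ (le_trans ?_ hεn)
        · exact le_trans
            (lintegral_mono fun ω => lintegral_mono fun z => min_le_right _ _)
            (le_iSup₂ (f := fun t (_ : t ∈ Tn n) =>
              ∫⁻ ω, ∫⁻ z, L t z ∂(τ n ω) ∂(P n t)) t (hn t ht))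
        · gcongr
          exact le_biSup_finset_real S
            (f := fun t => tvDist ((Q t).bind (K n)) (P n t)) (fun _ => tvDist_nonneg _ _) ht
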